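/- arXiv:1901.08371 — 7 statements merged into one kernel-verified Lean document; each statement's English description precedes it below -/
import Mathlib

section
/- Let q be a prime, G a commutative group of order q, and h, h₁, …, h_N ∈ G. Let M ∈ (ZMod q)^{N×N} be a permutation matrix and r ∈ (ZMod q)^N, and set c_i = h^{r_i} ∏_{j=1}^N h_j^{M_{j,i}} for each i. Then for every ω₁, c ∈ ZMod q, setting s₁ = ω₁ + c·(r_1 + ⋯ + r_N), the first verification equation holds: h^{ω₁} = (∏_{i=1}^N c_i / ∏_{i=1}^N h_i)^{-c} · h^{s₁}. -/
/-- Exponentiation of a monoid element by an element of `ZMod n`. -/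
instance (priority := low) monoidZModPow {M : Type*} [Monoid M] {n : ℕ} :
    Pow M (ZMod n) := ⟨fun g x => g ^ x.val⟩

/-- A permutation matrix: entries are 0 or 1, with exactly one 1 in each row and column. -/
def IsPermMatrix {N q : ℕ} (M : Matrix (Fin N) (Fin N) (ZMod q)) : Prop :=
  (∀ i j, M i j = 0 ∨ M i j = 1) ∧ (∀ i, ∃! j, M i j = 1) ∧ (∀ j, ∃! i, M i j = 1)

section ZModPow

variable {q : ℕ}

theorem zmod_pow_def {G : Type*} [Monoid G] (g : G) (x : ZMod q) : g ^ x = g ^ x.val := rfl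

theorem zmod_pow_eq_pow_of_natCast_eq [NeZero q] {G : Type*} [Monoid G] {g : G}
    (hg : g ^ q = 1) {x : ZMod q} {n : ℕ} (hn : (n : ZMod q) = x) : g ^ x = g ^ n := by
  rw [zmod_pow_def, ← hn, ZMod.val_natCast]
  exact (pow_eq_pow_mod n hg).symm

theorem zmod_pow_zero [NeZero q] {G : Type*} [Monoid G] (g : G) : g ^ (0 : ZMod q) = 1 := by
  simp [zmod_pow_def]

theorem zmod_pow_one [Fact (1 < q)] {G : Type*} [Monoid G] (g : G) : g ^ (1 : ZMod q) = g := by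
  rw [zmod_pow_def, ZMod.val_one, pow_one]

theorem zmod_pow_add [NeZero q] {G : Type*} [Monoid G] {g : G} (hg : g ^ q = 1)
    (x y : ZMod q) : g ^ (x + y) = g ^ x * g ^ y := by
  rw [zmod_pow_eq_pow_of_natCast_eq hg (n := x.val + y.val) (by simp), pow_add]
  rfl

theorem zmod_pow_mul [NeZero q] {G : Type*} [Monoid G] {g : G} (hg : g ^ q = 1)
    (x y : ZMod q) : g ^ (x * y) = (g ^ x) ^ y := by
  rw [zmod_pow_eq_pow_of_natCast_eq hg (n := x.val * y.val) (by simp), pow_mul]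
  rfl

theorem zmod_pow_sum [NeZero q] {G ι : Type*} [CommMonoid G] {g : G} (hg : g ^ q = 1)
    (s : Finset ι) (f : ι → ZMod q) : g ^ (∑ i ∈ s, f i) = ∏ i ∈ s, g ^ f i := by
  classical
  induction s using Finset.induction_on with
  | empty => simpa using zmod_pow_zero g
  | insert a s ha ih => rw [Finset.sum_insert ha, Finset.prod_insert ha, zmod_pow_add hg, ih]

theorem IsPermMatrix.prod_row_zmod_pow [Fact (1 < q)] [NeZero q] {G : Type*} [CommMonoid G]
    {N : ℕ} {M : Matrix (Fin N) (Fin N) (ZMod q)} (hM : IsPermMatrix M) (g : G) (j : Fin N) :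
    ∏ i, g ^ M j i = g := by
  obtain ⟨k, hk, huniq⟩ := hM.2.1 j
  rw [Finset.prod_eq_single k, hk, zmod_pow_one]
  · intro i _ hik
    rw [(hM.1 j i).resolve_right fun h => hik (huniq i h), zmod_pow_zero]
  · simp

end ZModPow

theorem stmt_1 {q : ℕ} [Fact (Nat.Prime q)] {G : Type*} [CommGroup G] [Fintype G]
    (hcard : Fintype.card G = q) {N : ℕ} (h : G) (hs : Fin N → G)
    (M : Matrix (Fin N) (Fin N) (ZMod q)) (hM : IsPermMatrix M)
    (r : Fin N → ZMod q) (cvec : Fin N → G)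
    (hc : ∀ i, cvec i = h ^ r i * ∏ j, hs j ^ M j i)
    (ω₁ c : ZMod q) (s₁ : ZMod q) (hs₁ : s₁ = ω₁ + c * ∑ i, r i) :
    h ^ ω₁ = ((∏ i, cvec i) / ∏ i, hs i) ^ (-c) * h ^ s₁ := by
  have hq : h ^ q = 1 := hcard ▸ pow_card_eq_one
  have hprod : ∏ i, cvec i = h ^ (∑ i, r i) * ∏ i, hs i := by
    simp_rw [hc, Finset.prod_mul_distrib, zmod_pow_sum hq]
    rw [Finset.prod_comm]
    simp_rw [hM.prod_row_zmod_pow]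
  rw [hprod, mul_div_cancel_right, ← zmod_pow_mul hq, ← zmod_pow_add hq, hs₁]
  congr 1
  ring
end

section
/- Let q be a prime, G a commutative group of order q, and h, h₁, …, h_N ∈ G. Let M ∈ (ZMod q)^{N×N} be a permutation matrix, r, u ∈ (ZMod q)^N, u' = Mu, and c_i = h^{r_i} ∏_{j=1}^N h_j^{M_{j,i}}. Then for every ω₃, c ∈ ZMod q and ω' ∈ (ZMod q)^N, setting s₃ = ω₃ + c·⟨r, u⟩ and s'_i = ω'_i + c·u'_i, the third verification equation holds: h^{ω₃} ∏_{i=1}^N h_i^{ω'_i} = (∏_{i=1}^N c_i^{u_i})^{-c} · h^{s₃} · ∏_{i=1}^N h_i^{s'_i}. -/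
section ZModPow

variable {q : ℕ} {G : Type*} [CommGroup G]

theorem zmodPow_def (g : G) (x : ZMod q) : g ^ x = g ^ x.val := rfl

theorem mul_zmodPow (a b : G) (x : ZMod q) : (a * b) ^ x = a ^ x * b ^ x := by
  simp only [zmodPow_def, mul_pow]

theorem prod_zmodPow {ι : Type*} (s : Finset ι) (f : ι → G) (x : ZMod q) :
    (∏ i ∈ s, f i) ^ x = ∏ i ∈ s, f i ^ x := by
  simp only [zmodPow_def, Finset.prod_pow]

variable [Fintype G]

theorem zmodPow_add [NeZero q] (hcard : Fintype.card G = q) (g : G) (x y : ZMod q) :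
    g ^ (x + y) = g ^ x * g ^ y := by
  simpa only [zmodPow_def, ZMod.val_add, ← pow_add, hcard] using pow_mod_card g (x.val + y.val)

theorem zmodPow_mul (hcard : Fintype.card G = q) (g : G) (x y : ZMod q) :
    g ^ (x * y) = (g ^ x) ^ y := by
  simpa only [zmodPow_def, ZMod.val_mul, ← pow_mul, hcard] using pow_mod_card g (x.val * y.val)

theorem zmodPow_sum [NeZero q] (hcard : Fintype.card G = q) {ι : Type*} (s : Finset ι)
    (g : G) (f : ι → ZMod q) : g ^ (∑ i ∈ s, f i) = ∏ i ∈ s, g ^ f i := by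
  classical
  induction s using Finset.induction_on with
  | empty => simp [zmodPow_def]
  | insert a s ha ih => rw [Finset.sum_insert ha, Finset.prod_insert ha, zmodPow_add hcard, ih]

/-- A product of powers of extended Pedersen commitments to the columns of `M` is a commitment
to `M.mulVec u`. -/
theorem prod_commitment_zmodPow [NeZero q] (hcard : Fintype.card G = q) {N : ℕ} (h : G)
    (hs : Fin N → G) (M : Matrix (Fin N) (Fin N) (ZMod q)) (r u : Fin N → ZMod q) :
    ∏ i, (h ^ r i * ∏ j, hs j ^ M j i) ^ u i =
      h ^ (∑ i, r i * u i) * ∏ j, hs j ^ M.mulVec u j := by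
  simp only [Matrix.mulVec, dotProduct, zmodPow_sum hcard, zmodPow_mul hcard, mul_zmodPow,
    prod_zmodPow, Finset.prod_mul_distrib]
  rw [Finset.prod_comm]

end ZModPow

theorem stmt_3 {q : ℕ} [Fact (Nat.Prime q)] {G : Type*} [CommGroup G] [Fintype G]
    (hcard : Fintype.card G = q) {N : ℕ} (h : G) (hs : Fin N → G)
    (M : Matrix (Fin N) (Fin N) (ZMod q)) (hM : IsPermMatrix M)
    (r u u' : Fin N → ZMod q) (hu' : u' = M.mulVec u)
    (cvec : Fin N → G)
    (hc : ∀ i, cvec i = h ^ r i * ∏ j, hs j ^ M j i)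
    (ω₃ c : ZMod q) (ω' : Fin N → ZMod q)
    (s₃ : ZMod q) (hs₃ : s₃ = ω₃ + c * ∑ i, r i * u i)
    (s' : Fin N → ZMod q) (hs' : ∀ i, s' i = ω' i + c * u' i) :
    h ^ ω₃ * ∏ i, hs i ^ ω' i =
      (∏ i, cvec i ^ u i) ^ (-c) * h ^ s₃ * ∏ i, hs i ^ s' i := by
  have : NeZero q := ⟨(Fact.out : q.Prime).ne_zero⟩
  have cancel : ∀ (g : G) (a b : ZMod q), (g ^ b) ^ (-c) * g ^ (a + c * b) = g ^ a := by
    intro g a b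
    rw [← zmodPow_mul hcard, ← zmodPow_add hcard]
    congr 1
    ring
  subst hu' hs₃
  simp only [hc, hs']
  rw [prod_commitment_zmodPow hcard, mul_zmodPow, prod_zmodPow, mul_right_comm (_ ^ (-c)), cancel, mul_assoc,
    ← Finset.prod_mul_distrib]
  simp only [cancel]
end

section
/- Let q be a prime, G a commutative group of order q, and h, h₁ ∈ G. Let r̂, u' ∈ (ZMod q)^N and define ĉ₀ = h₁, ĉ_i = h^{r̂_i} ĉ_{i-1}^{u'_i}. Then for every c ∈ ZMod q, ω̂, ω' ∈ (ZMod q)^N, setting ŝ_i = ω̂_i + c·r̂_i and s'_i = ω'_i + c·u'_i, the fifth verification equation holds for every i ∈ {1,…,N}: h^{ω̂_i} ĉ_{i-1}^{ω'_i} = ĉ_i^{-c} · h^{ŝ_i} · ĉ_{i-1}^{s'_i}. -/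
section ZModPow

variable {n : ℕ}

theorem pow_zmod_add [NeZero n] {M : Type*} [Monoid M] {g : M} (hg : g ^ n = 1) (a b : ZMod n) :
    g ^ (a + b) = g ^ a * g ^ b := by
  change g ^ (a + b).val = g ^ a.val * g ^ b.val
  rw [ZMod.val_add, ← pow_eq_pow_mod _ hg, pow_add]

theorem pow_zmod_mul {M : Type*} [Monoid M] {g : M} (hg : g ^ n = 1) (a b : ZMod n) :
    g ^ (a * b) = (g ^ a) ^ b := by
  change g ^ (a * b).val = (g ^ a.val) ^ b.val
  rw [ZMod.val_mul, ← pow_eq_pow_mod _ hg, pow_mul]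

theorem mul_pow_zmod {M : Type*} [CommMonoid M] (g k : M) (a : ZMod n) :
    (g * k) ^ a = g ^ a * k ^ a :=
  mul_pow g k a.val

end ZModPow

theorem stmt_5 {q : ℕ} [Fact (Nat.Prime q)] {G : Type*} [CommGroup G] [Fintype G]
    (hcard : Fintype.card G = q) (h h₁ : G) (N : ℕ)
    (rhat u' : ℕ → ZMod q) (chat : ℕ → G)
    (hchat0 : chat 0 = h₁)
    (hchat : ∀ i, 1 ≤ i → i ≤ N → chat i = h ^ rhat i * chat (i - 1) ^ u' i)
    (c : ZMod q) (ωhat ω' : ℕ → ZMod q)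
    (shat s' : ℕ → ZMod q)
    (hshat : ∀ i, shat i = ωhat i + c * rhat i)
    (hs' : ∀ i, s' i = ω' i + c * u' i) :
    ∀ i, 1 ≤ i → i ≤ N →
      h ^ ωhat i * chat (i - 1) ^ ω' i =
        chat i ^ (-c) * h ^ shat i * chat (i - 1) ^ s' i := by
  intro i hi hiN
  have hpow (g : G) : g ^ q = 1 := hcard ▸ pow_card_eq_one
  have hcancel (g : G) (r w : ZMod q) : g ^ w = (g ^ r) ^ (-c) * g ^ (w + c * r) := by
    rw [← pow_zmod_mul (hpow g), ← pow_zmod_add (hpow g)]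
    congr 1
    ring
  rw [hchat i hi hiN, hshat, hs', mul_pow_zmod, hcancel h (rhat i) (ωhat i),
    hcancel (chat (i - 1)) (u' i) (ω' i), mul_assoc (_ * _), mul_mul_mul_comm, mul_assoc]
end

section
/- (Completeness of the extended shuffle proof.) Let q be a prime, G a commutative group of order q, h, h₁, …, h_N, g, pk ∈ G. Let M ∈ (ZMod q)^{N×N} be a permutation matrix with associated permutation π, r ∈ (ZMod q)^N, R ∈ (ZMod q)^{w×N}, c_i = h^{r_i} ∏_j h_j^{M_{j,i}}, e_1,…,e_N ∈ (G×G)^w and e'_i = ReEnc(e_{π(i)}, R_{π(i)}). For any challenge vector u ∈ (ZMod q)^N, set u' = Mu; for any r̂ ∈ (ZMod q)^N define ĉ₀ = h₁, ĉ_i = h^{r̂_i} ĉ_{i-1}^{u'_i}; set r̄ = Σ_i r_i, r̃ = ⟨r,u⟩, r⋄ = r̂_N + Σ_{i=1}^{N-1} r̂_i ∏_{j=i+1}^N u'_j, r⋆ = Ru; for any ω₁, ω₂, ω₃ ∈ ZMod q, ω₄ ∈ (ZMod q)^w, ω̂, ω' ∈ (ZMod q)^N, define t₁ = h^{ω₁},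 t₂ = h^{ω₂}, t₃ = h^{ω₃}∏_i h_i^{ω'_i}, t₄ = ReEnc(∏_i (e'_i)^{ω'_i}, -ω₄), t̂_i = h^{ω̂_i} ĉ_{i-1}^{ω'_i}; and for any challenge c ∈ ZMod q set s₁ = ω₁ + c·r̄, s₂ = ω₂ + c·r⋄, s₃ = ω₃ + c·r̃, s₄ = ω₄ + c·r⋆, ŝ = ω̂ + c·r̂, s' = ω' + c·u'. Then all five verification equations hold: t₁ = (∏_i c_i/∏_i h_i)^{-c} h^{s₁}, t₂ = (ĉ_N/h₁^{∏_i u_i})^{-c} h^{s₂}, t₃ = (∏_i c_i^{u_i})^{-c} h^{s₃} ∏_i h_i^{s'_i}, t₄ = ReEnc((∏_i e_i^{u_i})^{-c} ∏_i (e'_i)^{s'_i}, -s₄), and t̂_i = ĉ_i^{-c} h^{ŝ_i} ĉ_{i-1}^{s'_i} for all i. -/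
/-- A permutation matrix (indexed by `1, …, N`): entries are 0 or 1,
with exactly one 1 in each row and column. -/
def IsPermMatrixIcc {q : ℕ} (N : ℕ) (M : ℕ → ℕ → ZMod q) : Prop :=
  (∀ i ∈ Finset.Icc 1 N, ∀ j ∈ Finset.Icc 1 N, M i j = 0 ∨ M i j = 1) ∧
  (∀ i ∈ Finset.Icc 1 N, ∃! j, j ∈ Finset.Icc 1 N ∧ M i j = 1) ∧
  (∀ j ∈ Finset.Icc 1 N, ∃! i, i ∈ Finset.Icc 1 N ∧ M i j = 1)

/-- Componentwise ElGamal encryption of a width-`w` vector of messages. -/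
def EncV {G : Type*} [CommGroup G] {q w : ℕ} (g pk : G)
    (m : Fin w → G) (r : Fin w → ZMod q) : Fin w → G × G :=
  fun k => (g ^ r k, pk ^ r k * m k)

/-- Componentwise re-encryption: `ReEnc(e, r) = e · Enc(1, r)`. -/
def ReEncV {G : Type*} [CommGroup G] {q w : ℕ} (g pk : G)
    (e : Fin w → G × G) (r : Fin w → ZMod q) : Fin w → G × G :=
  e * EncV g pk 1 r

namespace ZModPow

variable {G : Type*} [CommGroup G] {q : ℕ}

theorem pow_eq_val (a : G) (x : ZMod q) : a ^ x = a ^ x.val := rfl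

theorem pow_zero (a : G) : a ^ (0 : ZMod q) = 1 := by
  cases q <;> simp [pow_eq_val]

theorem mul_pow (a b : G) (x : ZMod q) : (a * b) ^ x = a ^ x * b ^ x :=
  _root_.mul_pow a b x.val

theorem prod_pow {ι : Type*} (s : Finset ι) (f : ι → G) (x : ZMod q) :
    (∏ i ∈ s, f i) ^ x = ∏ i ∈ s, f i ^ x :=
  (Finset.prod_pow s x.val f).symm

theorem pow_mod_card [Fintype G] (hG : Fintype.card G = q) (a : G) (n : ℕ) :
    a ^ (n % q) = a ^ n := by
  rw [← hG, _root_.pow_mod_card]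

variable [Fact q.Prime]

theorem pow_one (a : G) : a ^ (1 : ZMod q) = a := by
  have : Fact (1 < q) := ⟨(Fact.out : q.Prime).one_lt⟩
  simp [pow_eq_val, ZMod.val_one]

variable [Fintype G]

theorem pow_add (hG : Fintype.card G = q) (a : G) (x y : ZMod q) :
    a ^ (x + y) = a ^ x * a ^ y := by
  simp only [pow_eq_val, ZMod.val_add, pow_mod_card hG, _root_.pow_add]

theorem pow_mul (hG : Fintype.card G = q) (a : G) (x y : ZMod q) :
    a ^ (x * y) = (a ^ x) ^ y := by
  simp only [pow_eq_val, ZMod.val_mul, pow_mod_card hG, _root_.pow_mul]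

theorem pow_neg (hG : Fintype.card G = q) (a : G) (x : ZMod q) :
    a ^ (-x) = (a ^ x)⁻¹ := by
  rw [eq_inv_iff_mul_eq_one, ← pow_add hG, neg_add_cancel, pow_zero]

theorem pow_sum (hG : Fintype.card G = q) {ι : Type*} (s : Finset ι) (a : G)
    (f : ι → ZMod q) : a ^ (∑ i ∈ s, f i) = ∏ i ∈ s, a ^ f i := by
  classical
  induction s using Finset.induction_on with
  | empty => simp [pow_zero]
  | insert i s hi ih => rw [Finset.sum_insert hi, Finset.prod_insert hi, pow_add hG, ih]

theorem prod_pow_mul_add (hG : Fintype.card G = q) {ι : Type*} (s : Finset ι) (a : ι → G)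
    (x y : ι → ZMod q) (c : ZMod q) :
    ∏ i ∈ s, a i ^ (x i + c * y i) = (∏ i ∈ s, a i ^ x i) * (∏ i ∈ s, a i ^ y i) ^ c := by
  rw [prod_pow, ← Finset.prod_mul_distrib]
  refine Finset.prod_congr rfl fun i _ => ?_
  rw [pow_add hG, mul_comm c, pow_mul hG]

/-- The verification equation of a Schnorr proof, for a commitment `a ^ ω` with response
`ω + c * x` to the challenge `c`. -/
theorem schnorr (hG : Fintype.card G = q) (a : G) (ω c x : ZMod q) :
    a ^ ω = (a ^ x) ^ (-c) * a ^ (ω + c * x) := by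
  rw [← pow_mul hG, ← pow_add hG]
  congr 1
  ring

/-- The verification equation of a Schnorr proof for a blinded value `a ^ x * B`. -/
theorem schnorr_blinded (hG : Fintype.card G = q) (a A B : G) (ω c x : ZMod q) :
    a ^ ω * A = (a ^ x * B) ^ (-c) * a ^ (ω + c * x) * (A * B ^ c) := by
  rw [mul_pow, mul_right_comm _ (B ^ (-c)), ← schnorr hG, pow_neg hG, mul_comm A, mul_assoc,
    inv_mul_cancel_left]

theorem prod_pedersen_pow (hG : Fintype.card G = q) {ι : Type*} (s : Finset ι) (h : G)
    (a : ι → G) (M : ι → ι → ZMod q) (r u : ι → ZMod q) :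
    ∏ i ∈ s, (h ^ r i * ∏ j ∈ s, a j ^ M j i) ^ u i =
      h ^ (∑ i ∈ s, r i * u i) * ∏ j ∈ s, a j ^ (∑ i ∈ s, M j i * u i) := by
  simp only [mul_pow, prod_pow, ← pow_mul hG, pow_sum hG, Finset.prod_mul_distrib]
  rw [Finset.prod_comm]

theorem prod_reindexed_blind_pow (hG : Fintype.card G = q) {ι : Type*} {s : Finset ι}
    {σ : ι → ι} (hσ : Set.BijOn σ s s) (b : G) (a : ι → G) (ρ u : ι → ZMod q) :
    ∏ i ∈ s, (a (σ i) * b ^ ρ (σ i)) ^ u (σ i) =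
      (∏ i ∈ s, a i ^ u i) * b ^ (∑ i ∈ s, ρ i * u i) := by
  rw [Finset.prod_nbij (t := s) (g := fun i => (a i * b ^ ρ i) ^ u i) σ
    (fun i hi => hσ.mapsTo hi) hσ.injOn hσ.surjOn fun _ _ => rfl]
  simp only [mul_pow, ← pow_mul hG, pow_sum hG, Finset.prod_mul_distrib]

/-- The verification equation of the re-encryption proof, in one component. -/
theorem reencryption_verifies (hG : Fintype.card G = q) {ι : Type*} {s : Finset ι}
    {σ : ι → ι} (hσ : Set.BijOn σ s s) (b : G) (a : ι → G) (ρ u x : ι → ZMod q)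
    (ω c : ZMod q) :
    (∏ i ∈ s, (a (σ i) * b ^ ρ (σ i)) ^ x i) * b ^ (-ω) =
      (∏ i ∈ s, a i ^ u i) ^ (-c) * (∏ i ∈ s, (a (σ i) * b ^ ρ (σ i)) ^ (x i + c * u (σ i))) *
        b ^ (-(ω + c * ∑ i ∈ s, ρ i * u i)) := by
  rw [prod_pow_mul_add hG, prod_reindexed_blind_pow hG hσ, mul_pow,
    mul_comm c, pow_neg hG, pow_neg hG, pow_neg hG, pow_add hG, pow_mul hG b _ c]
  simp only [mul_inv]
  generalize (∏ i ∈ s, a i ^ u i) ^ c = A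
  generalize (b ^ (∑ i ∈ s, ρ i * u i)) ^ c = B
  rw [mul_left_comm _ A, inv_mul_cancel_left, mul_comm _ B, mul_comm _ B⁻¹, mul_mul_mul_comm,
    mul_inv_cancel, one_mul]

theorem commitment_chain (hG : Fintype.card G = q) (h : G) (a : ℕ → G) (x y : ℕ → ZMod q)
    {N : ℕ} (ha : ∀ i, 1 ≤ i → i ≤ N → a i = h ^ x i * a (i - 1) ^ y i) :
    a N = h ^ (∑ i ∈ Finset.Icc 1 N, x i * ∏ j ∈ Finset.Icc (i + 1) N, y j) *
      a 0 ^ (∏ i ∈ Finset.Icc 1 N, y i) := by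
  induction N with
  | zero => simp [pow_zero, pow_one]
  | succ n ih =>
    have hsum : ∑ i ∈ Finset.Icc 1 n, x i * ∏ j ∈ Finset.Icc (i + 1) (n + 1), y j =
        (∑ i ∈ Finset.Icc 1 n, x i * ∏ j ∈ Finset.Icc (i + 1) n, y j) * y (n + 1) := by
      rw [Finset.sum_mul]
      refine Finset.sum_congr rfl fun i hi => ?_
      rw [Finset.prod_Icc_succ_top (by have := (Finset.mem_Icc.mp hi).2; omega), mul_assoc]
    rw [ha (n + 1) (by omega) le_rfl, Nat.add_sub_cancel,
      ih fun i h₁ h₂ => ha i h₁ (h₂.trans n.le_succ),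
      Finset.sum_Icc_succ_top (Nat.le_add_left 1 n), hsum,
      Finset.prod_Icc_succ_top (Nat.le_add_left 1 n),
      Finset.Icc_eq_empty_of_lt (Nat.lt_succ_self (n + 1)), Finset.prod_empty, mul_one,
      pow_add hG, mul_pow, pow_mul hG, pow_mul hG, mul_left_comm, mul_assoc]

end ZModPow

theorem ReEncV_apply {G : Type*} [CommGroup G] {q w : ℕ} (g pk : G) (e : Fin w → G × G)
    (r : Fin w → ZMod q) (k : Fin w) :
    ReEncV g pk e r k = ((e k).1 * g ^ r k, (e k).2 * pk ^ r k) := by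
  simp [ReEncV, EncV, Prod.ext_iff]

theorem prod_ciphertext_pow_apply {G : Type*} [CommGroup G] {q w : ℕ} {ι : Type*}
    (s : Finset ι) (e : ι → Fin w → G × G) (x : ι → ZMod q) (k : Fin w) :
    (∏ i ∈ s, e i ^ x i) k = (∏ i ∈ s, (e i k).1 ^ x i, ∏ i ∈ s, (e i k).2 ^ x i) := by
  rw [Finset.prod_apply]
  exact Prod.ext Prod.fst_prod Prod.snd_prod

theorem ciphertext_pow_apply {G : Type*} [CommGroup G] {q w : ℕ}
    (e : Fin w → G × G) (x : ZMod q) (k : Fin w) :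
    (e ^ x) k = ((e k).1 ^ x, (e k).2 ^ x) := rfl

theorem IsPermMatrixIcc.bijOn {q : ℕ} [Fact q.Prime] {N : ℕ} {M : ℕ → ℕ → ZMod q}
    (hM : IsPermMatrixIcc N M) {π : ℕ → ℕ}
    (hπ : ∀ (x : ℕ → ZMod q), ∀ i ∈ Finset.Icc 1 N,
      ∑ j ∈ Finset.Icc 1 N, M i j * x j = x (π i)) :
    Set.BijOn π (Finset.Icc 1 N) (Finset.Icc 1 N) := by
  have key : ∀ i ∈ Finset.Icc 1 N, ∀ j ∈ Finset.Icc 1 N, M i j = 1 → π i = j := by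
    intro i hi j hj hij
    have hsingle := hπ (Pi.single j 1) i hi
    by_contra hne
    simp [Pi.single_apply, hne, hij, Finset.mem_Icc.mp hj] at hsingle
  have hmem : ∀ i ∈ Finset.Icc 1 N, π i ∈ Finset.Icc 1 N ∧ M i (π i) = 1 := by
    intro i hi
    obtain ⟨j, ⟨hj, hij⟩, -⟩ := hM.2.1 i hi
    rw [key i hi j hj hij]
    exact ⟨hj, hij⟩
  refine ⟨fun i hi => (hmem i hi).1, fun i hi k hk hik => ?_, fun j hj => ?_⟩
  · refine (hM.2.2 (π i) (hmem i hi).1).unique ⟨hi, (hmem i hi).2⟩ ⟨hk, ?_⟩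
    rw [hik]
    exact (hmem k hk).2
  · obtain ⟨i, ⟨hi, hij⟩, -⟩ := hM.2.2 j hj
    exact ⟨i, hi, key i hi j hj hij⟩

/-- Completeness of the extended shuffle proof: an honest prover makes all five
verification equations hold. -/
theorem stmt_6 {q : ℕ} [Fact (Nat.Prime q)] {G : Type*} [CommGroup G] [Fintype G]
    (hcard : Fintype.card G = q)
    (N w : ℕ) (hN : 1 ≤ N)
    (h g pk : G) (hs : ℕ → G)
    (M : ℕ → ℕ → ZMod q) (hM : IsPermMatrixIcc N M)
    (π : ℕ → ℕ)
    (hπ : ∀ (x : ℕ → ZMod q), ∀ i ∈ Finset.Icc 1 N,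
      ∑ j ∈ Finset.Icc 1 N, M i j * x j = x (π i))
    (r : ℕ → ZMod q) (R : Fin w → ℕ → ZMod q)
    (cvec : ℕ → G)
    (hcvec : ∀ i ∈ Finset.Icc 1 N, cvec i = h ^ r i * ∏ j ∈ Finset.Icc 1 N, hs j ^ M j i)
    (e e' : ℕ → Fin w → G × G)
    (he' : ∀ i ∈ Finset.Icc 1 N, e' i = ReEncV g pk (e (π i)) (fun k => R k (π i)))
    (u u' : ℕ → ZMod q)
    (hu' : ∀ i ∈ Finset.Icc 1 N, u' i = ∑ j ∈ Finset.Icc 1 N, M i j * u j)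
    (rhat : ℕ → ZMod q) (chat : ℕ → G)
    (hchat0 : chat 0 = hs 1)
    (hchat : ∀ i, 1 ≤ i → i ≤ N → chat i = h ^ rhat i * chat (i - 1) ^ u' i)
    (rbar rtil rdiam : ZMod q) (rstar : Fin w → ZMod q)
    (hrbar : rbar = ∑ i ∈ Finset.Icc 1 N, r i)
    (hrtil : rtil = ∑ i ∈ Finset.Icc 1 N, r i * u i)
    (hrdiam : rdiam = rhat N +
      ∑ i ∈ Finset.Icc 1 (N - 1), rhat i * ∏ j ∈ Finset.Icc (i + 1) N, u' j)
    (hrstar : rstar = fun k => ∑ j ∈ Finset.Icc 1 N, R k j * u j)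
    (ω₁ ω₂ ω₃ : ZMod q) (ω₄ : Fin w → ZMod q) (ωhat ω' : ℕ → ZMod q)
    (t₁ t₂ t₃ : G) (t₄ : Fin w → G × G) (that : ℕ → G)
    (ht₁ : t₁ = h ^ ω₁) (ht₂ : t₂ = h ^ ω₂)
    (ht₃ : t₃ = h ^ ω₃ * ∏ i ∈ Finset.Icc 1 N, hs i ^ ω' i)
    (ht₄ : t₄ = ReEncV g pk (∏ i ∈ Finset.Icc 1 N, e' i ^ ω' i) (-ω₄))
    (hthat : ∀ i, 1 ≤ i → i ≤ N → that i = h ^ ωhat i * chat (i - 1) ^ ω' i)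
    (c : ZMod q)
    (s₁ s₂ s₃ : ZMod q) (s₄ : Fin w → ZMod q) (shat s' : ℕ → ZMod q)
    (hs₁ : s₁ = ω₁ + c * rbar) (hs₂ : s₂ = ω₂ + c * rdiam) (hs₃ : s₃ = ω₃ + c * rtil)
    (hs₄ : s₄ = fun k => ω₄ k + c * rstar k)
    (hshat : ∀ i, shat i = ωhat i + c * rhat i)
    (hsp : ∀ i, s' i = ω' i + c * u' i) :
    t₁ = ((∏ i ∈ Finset.Icc 1 N, cvec i) / ∏ i ∈ Finset.Icc 1 N, hs i) ^ (-c) * h ^ s₁ ∧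
    t₂ = (chat N / hs 1 ^ (∏ i ∈ Finset.Icc 1 N, u i)) ^ (-c) * h ^ s₂ ∧
    t₃ = (∏ i ∈ Finset.Icc 1 N, cvec i ^ u i) ^ (-c) * h ^ s₃
          * ∏ i ∈ Finset.Icc 1 N, hs i ^ s' i ∧
    t₄ = ReEncV g pk
          ((∏ i ∈ Finset.Icc 1 N, e i ^ u i) ^ (-c) * ∏ i ∈ Finset.Icc 1 N, e' i ^ s' i)
          (-s₄) ∧
    ∀ i, 1 ≤ i → i ≤ N → that i = chat i ^ (-c) * h ^ shat i * chat (i - 1) ^ s' i := by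
  have hbij := hM.bijOn hπ
  have hu : ∀ i ∈ Finset.Icc 1 N, u' i = u (π i) := fun i hi => (hu' i hi).trans (hπ u i hi)
  subst ht₁ ht₂ ht₃ ht₄ hs₁ hs₂ hs₃ hs₄ hrbar hrtil hrdiam hrstar
  refine ⟨?_, ?_, ?_, ?_, ?_⟩
  · have hprod := ZModPow.prod_pedersen_pow hcard (Finset.Icc 1 N) h hs M r 1
    simp only [Pi.one_apply, mul_one, ZModPow.pow_one] at hprod
    have hrow : ∀ j ∈ Finset.Icc 1 N, hs j ^ (∑ i ∈ Finset.Icc 1 N, M j i) = hs j := by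
      intro j hj
      have := hπ 1 j hj
      simp only [Pi.one_apply, mul_one] at this
      rw [this, ZModPow.pow_one]
    rw [Finset.prod_congr rfl hcvec, hprod, Finset.prod_congr rfl hrow, mul_div_cancel_right]
    exact ZModPow.schnorr hcard h _ _ _
  · have hprod : ∏ i ∈ Finset.Icc 1 N, u' i = ∏ i ∈ Finset.Icc 1 N, u i := by
      rw [Finset.prod_congr rfl hu]
      exact Finset.prod_nbij π (fun i hi => hbij.mapsTo hi) hbij.injOn hbij.surjOn
        fun _ _ => rfl
    have hsum : ∑ i ∈ Finset.Icc 1 N, rhat i * ∏ j ∈ Finset.Icc (i + 1) N, u' j =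
        rhat N + ∑ i ∈ Finset.Icc 1 (N - 1), rhat i * ∏ j ∈ Finset.Icc (i + 1) N, u' j := by
      obtain ⟨n, rfl⟩ := Nat.exists_eq_add_of_le' hN
      rw [Finset.sum_Icc_succ_top (by omega), add_comm]
      simp
    rw [ZModPow.commitment_chain hcard h chat rhat u' hchat, hchat0, hprod,
      mul_div_cancel_right, hsum]
    exact ZModPow.schnorr hcard h _ _ _
  · have hprod : ∏ i ∈ Finset.Icc 1 N, cvec i ^ u i =
        h ^ (∑ i ∈ Finset.Icc 1 N, r i * u i) * ∏ i ∈ Finset.Icc 1 N, hs i ^ u' i := by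
      rw [Finset.prod_congr rfl fun i hi => congrArg (· ^ u i) (hcvec i hi),
        ZModPow.prod_pedersen_pow hcard]
      congr 1
      exact Finset.prod_congr rfl fun i hi => by rw [hu' i hi]
    rw [hprod, Finset.prod_congr rfl fun i _ => congrArg (hs i ^ ·) (hsp i),
      ZModPow.prod_pow_mul_add hcard]
    exact ZModPow.schnorr_blinded hcard h _ _ _ _ _
  · funext k
    have hfst := ZModPow.reencryption_verifies hcard hbij g (fun i => (e i k).1) (R k) u ω'
      (ω₄ k) c
    have hsnd := ZModPow.reencryption_verifies hcard hbij pk (fun i => (e i k).2) (R k) u ω'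
      (ω₄ k) c
    have hre : ∀ i ∈ Finset.Icc 1 N,
        e' i k = ((e (π i) k).1 * g ^ R k (π i), (e (π i) k).2 * pk ^ R k (π i)) := by
      intro i hi
      rw [he' i hi, ReEncV_apply]
    have hcomp : ∀ x : ℕ → ZMod q, (∏ i ∈ Finset.Icc 1 N, e' i ^ x i) k =
        (∏ i ∈ Finset.Icc 1 N, ((e (π i) k).1 * g ^ R k (π i)) ^ x i,
          ∏ i ∈ Finset.Icc 1 N, ((e (π i) k).2 * pk ^ R k (π i)) ^ x i) := by
      intro x
      rw [prod_ciphertext_pow_apply]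
      congr 1 <;> exact Finset.prod_congr rfl fun i hi => by rw [hre i hi]
    have hs' : ∀ a : ℕ → G, ∏ i ∈ Finset.Icc 1 N, a i ^ s' i =
        ∏ i ∈ Finset.Icc 1 N, a i ^ (ω' i + c * u (π i)) := fun a =>
      Finset.prod_congr rfl fun i hi => by rw [hsp i, hu i hi]
    simp only [ReEncV_apply, Pi.mul_apply, Pi.neg_apply, hcomp, hs', ciphertext_pow_apply,
      prod_ciphertext_pow_apply]
    exact Prod.ext hfst hsnd
  · intro i h₁ h₂
    rw [hthat i h₁ h₂, hshat, hsp, hchat i h₁ h₂, ZModPow.pow_add hcard (chat (i - 1)),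
      mul_comm c (u' i), ZModPow.pow_mul hcard (chat (i - 1))]
    exact ZModPow.schnorr_blinded hcard h _ _ _ _ _
end

section
/- Let q be a prime, G a commutative group of order q, and h, h₁, …, h_N ∈ G. Suppose c₁,…,c_N, t₁ ∈ G and c, c*, s₁, s₁* ∈ ZMod q satisfy c ≠ c*, t₁ = (∏_{i=1}^N c_i / ∏_{i=1}^N h_i)^{-c} h^{s₁} and t₁ = (∏_{i=1}^N c_i / ∏_{i=1}^N h_i)^{-c*} h^{s₁*}. Then ∏_{j=1}^N c_j = h^{(s₁-s₁*)/(c-c*)} ∏_{i=1}^N h_i, i.e. ∏_j c_j is the extended Pedersen commitment EPC(𝟏, r̄) to the all-ones vector with randomness r̄ = (s₁-s₁*)/(c-c*). -/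
/-- The extended Pedersen commitment `EPC(m, r) = h^r ∏ i, hᵢ^(mᵢ)`. -/
def EPC {G : Type*} [CommGroup G] {q N : ℕ} (h : G) (hs : Fin N → G)
    (m : Fin N → ZMod q) (r : ZMod q) : G :=
  h ^ r * ∏ i, hs i ^ m i

theorem pow_zmod_def {M : Type*} [Monoid M] {n : ℕ} (g : M) (x : ZMod n) :
    g ^ x = g ^ x.val := rfl

section PowZMod

variable {G : Type*} [Group G] {q : ℕ}

theorem pow_zmod_add_s7 [NeZero q] {g : G} (hg : g ^ q = 1) (x y : ZMod q) :
    g ^ (x + y) = g ^ x * g ^ y := by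
  simp only [pow_zmod_def]
  rw [ZMod.val_add, ← pow_add, ← pow_eq_pow_mod _ hg]

theorem pow_zmod_mul_s7 {g : G} (hg : g ^ q = 1) (x y : ZMod q) :
    g ^ (x * y) = (g ^ x) ^ y := by
  simp only [pow_zmod_def]
  rw [ZMod.val_mul, ← pow_mul, ← pow_eq_pow_mod _ hg]

theorem pow_zmod_one [Fact (1 < q)] (g : G) : g ^ (1 : ZMod q) = g := by
  rw [pow_zmod_def, ZMod.val_one, pow_one]

theorem pow_zmod_zero (g : G) : g ^ (0 : ZMod q) = 1 := by
  rw [pow_zmod_def, ZMod.val_zero, pow_zero]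

theorem pow_zmod_sub [NeZero q] {g : G} (hg : g ^ q = 1) (x y : ZMod q) :
    g ^ (x - y) = g ^ x / g ^ y := by
  rw [eq_div_iff_mul_eq', ← pow_zmod_add_s7 hg, sub_add_cancel]

theorem pow_zmod_neg [NeZero q] {g : G} (hg : g ^ q = 1) (x : ZMod q) :
    g ^ (-x) = (g ^ x)⁻¹ := by
  rw [eq_inv_iff_mul_eq_one, ← pow_zmod_add_s7 hg, neg_add_cancel, pow_zmod_zero]

end PowZMod

theorem stmt_7 {q : ℕ} [Fact (Nat.Prime q)] {G : Type*} [CommGroup G] [Fintype G]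
    (hcard : Fintype.card G = q) {N : ℕ} (h : G) (hs : Fin N → G)
    (cvec : Fin N → G) (t₁ : G) (c cstar s₁ s₁star : ZMod q)
    (hne : c ≠ cstar)
    (h1 : t₁ = ((∏ i, cvec i) / ∏ i, hs i) ^ (-c) * h ^ s₁)
    (h2 : t₁ = ((∏ i, cvec i) / ∏ i, hs i) ^ (-cstar) * h ^ s₁star) :
    ∏ j, cvec j = EPC h hs (fun _ => 1) ((s₁ - s₁star) / (c - cstar)) := by
  have hq : ∀ g : G, g ^ q = 1 := fun g => hcard ▸ pow_card_eq_one
  have hd : c - cstar ≠ 0 := sub_ne_zero.mpr hne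
  set a := (∏ i, cvec i) / ∏ i, hs i with ha
  have key : a ^ (c - cstar) = h ^ (s₁ - s₁star) := by
    have e := h1.symm.trans h2
    rw [pow_zmod_neg (hq a), pow_zmod_neg (hq a), inv_mul_eq_iff_eq_mul] at e
    rw [pow_zmod_sub (hq a), pow_zmod_sub (hq h), e, ← mul_assoc, ← div_eq_mul_inv,
      mul_div_cancel_right]
  have hpow : a = h ^ ((s₁ - s₁star) / (c - cstar)) := by
    rw [div_eq_mul_inv, pow_zmod_mul_s7 (hq h), ← key, ← pow_zmod_mul_s7 (hq a),
      mul_inv_cancel₀ hd, pow_zmod_one]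
  simp only [EPC, pow_zmod_one]
  rw [← hpow, ha, div_mul_cancel]
end

section
/- (Theorem 1 of Terelius–Wikström, used in the soundness proof.) Let q be a prime, N ≥ 1, and M ∈ (ZMod q)^{N×N} with q > N. Then M is a permutation matrix if and only if M𝟏 = 𝟏 and the polynomial identity ∏_{i=1}^N ⟨m_i, X⟩ = ∏_{i=1}^N X_i holds in the multivariate polynomial ring (ZMod q)[X₁,…,X_N], where m_i denotes the i-th row of M and ⟨m_i, X⟩ = Σ_{j=1}^N M_{i,j} X_j. -/
/-- If a variable divides a linear form, all other coefficients of the form vanish. -/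
theorem MvPolynomial.eq_zero_of_X_dvd_linearForm {σ R : Type*} [Fintype σ] [CommRing R]
    {a : σ → R} {j k : σ} (hkj : k ≠ j)
    (h : (X j : MvPolynomial σ R) ∣ ∑ l, C (a l) * X l) : a k = 0 := by
  classical
  obtain ⟨r, hr⟩ := h
  have := congrArg (eval (Pi.single k 1)) hr
  simpa [Pi.single_apply, hkj.symm] using this

/-- Theorem 1 of Terelius–Wikström: `M` is a permutation matrix iff `M𝟏 = 𝟏` and
`∏ i, ⟨mᵢ, X⟩ = ∏ i, Xᵢ` as multivariate polynomials. -/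
theorem stmt_14 {q : ℕ} [Fact (Nat.Prime q)] {N : ℕ} (hN : 1 ≤ N) (hqN : N < q)
    (M : Matrix (Fin N) (Fin N) (ZMod q)) :
    IsPermMatrix M ↔
      (M.mulVec 1 = 1 ∧
        ∏ i, (∑ j, MvPolynomial.C (M i j) * MvPolynomial.X j) =
          ∏ i, (MvPolynomial.X i : MvPolynomial (Fin N) (ZMod q))) := by
  constructor
  · rintro ⟨h01, hrow, hcol⟩
    choose σ hσ hσ_unique using hrow
    have hM : ∀ i j, M i j = if j = σ i then 1 else 0 := by
      intro i j
      split_ifs with h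
      · exact h ▸ hσ i
      · exact (h01 i j).resolve_right fun h1 => h (hσ_unique i j h1)
    have hbij : Function.Bijective σ := by
      refine Finite.injective_iff_bijective.mp fun a b hab => ?_
      exact (hcol (σ a)).unique (hσ a) (hab ▸ hσ b)
    refine ⟨?_, ?_⟩
    · ext i
      simp [Matrix.mulVec, dotProduct, hM]
    · rw [← hbij.prod_comp (fun i => (MvPolynomial.X i : MvPolynomial (Fin N) (ZMod q)))]
      refine Finset.prod_congr rfl fun i _ => ?_
      simp [hM]
  · rintro ⟨hone, hprod⟩
    have hsum : ∀ i, ∑ j, M i j = 1 := fun i => by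
      simpa [Matrix.mulVec, dotProduct] using congrFun hone i
    have hdvd : ∀ j, ∃ i, (MvPolynomial.X j : MvPolynomial (Fin N) (ZMod q)) ∣
        ∑ l, MvPolynomial.C (M i l) * MvPolynomial.X l := by
      intro j
      have h := Finset.dvd_prod_of_mem
        (fun i => (MvPolynomial.X i : MvPolynomial (Fin N) (ZMod q))) (Finset.mem_univ j)
      rw [← hprod] at h
      obtain ⟨i, -, hi⟩ := (MvPolynomial.X_prime.dvd_finsetProd_iff _).mp h
      exact ⟨i, hi⟩
    choose f hf using hdvd
    have hzero : ∀ j k, k ≠ j → M (f j) k = 0 := fun j k hkj =>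
      MvPolynomial.eq_zero_of_X_dvd_linearForm hkj (hf j)
    have hdiag : ∀ j, M (f j) j = 1 := fun j => by
      rw [← hsum (f j)]
      exact (Finset.sum_eq_single j (fun k _ hk => hzero j k hk) (by simp)).symm
    have hinj : Function.Injective f := by
      intro a b hab
      by_contra hne
      have h := hzero b a hne
      rw [← hab, hdiag a] at h
      exact one_ne_zero h
    have hsurj : Function.Surjective f := Finite.surjective_of_injective hinj
    have hone_iff : ∀ j k, M (f j) k = 1 → k = j := by
      intro j k h
      by_contra hne
      rw [hzero j k hne] at h
      exact zero_ne_one h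
    refine ⟨fun i j => ?_, fun i => ?_, fun j => ⟨f j, hdiag j, fun i hi => ?_⟩⟩
    · obtain ⟨k, rfl⟩ := hsurj i
      by_cases h : j = k
      · exact Or.inr (h ▸ hdiag j)
      · exact Or.inl (hzero k j h)
    · obtain ⟨k, rfl⟩ := hsurj i
      exact ⟨k, hdiag k, hone_iff k⟩
    · obtain ⟨k, rfl⟩ := hsurj i
      rw [hone_iff k j hi]
end

section
/- Let q be a prime, G a commutative group of order q, g, pk ∈ G, and Enc(m,r) = (g^r, pk^r m) ∈ G×G, extended componentwise to width-w vectors, with ReEnc(e,r) = e·Enc(1,r). Let U ∈ (ZMod q)^{N×N} be invertible with inverse A, let M ∈ (ZMod q)^{N×N} be a permutation matrix with associated permutation π_M, set U' = MU, let e_1,…,e_N, e'_1,…,e'_N ∈ (G×G)^w and R⋆ ∈ (ZMod q)^{w×N}, and suppose that for every j, ∏_{i=1}^N e_i^{U_{i,j}} = (∏_{i=1}^N (e'_i)^{U'_{i,j}}) · Enc(1, -R⋆_j), where R⋆_j is the j-th column of R⋆. Then for every l, e_l = e'_{π_M^{-1}(l)} · Enc(1, -Σ_{j=1}^N A_{j,l}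 R⋆_j); equivalently, e'_{π_M^{-1}(l)} = ReEnc(e_l, Σ_{j=1}^N A_{j,l} R⋆_j). -/
section ZModExponent

variable {H : Type*} [CommGroup H] {q : ℕ}

theorem EncV_one {w : ℕ} (g pk : H) (r : Fin w → ZMod q) :
    EncV g pk 1 r = fun k => (g ^ (r k).val, pk ^ (r k).val) :=
  funext fun _ => Prod.ext rfl (mul_one _)

theorem pow_val_mul (hq : ∀ x : H, x ^ q = 1) (x : H) (a b : ZMod q) :
    x ^ (a * b).val = (x ^ a.val) ^ b.val := by
  rw [ZMod.val_mul, ← pow_mul, ← pow_eq_pow_mod _ (hq x)]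

variable [NeZero q]

theorem pow_val_add (hq : ∀ x : H, x ^ q = 1) (x : H) (a b : ZMod q) :
    x ^ (a + b).val = x ^ a.val * x ^ b.val := by
  rw [ZMod.val_add, ← pow_add, ← pow_eq_pow_mod _ (hq x)]

theorem pow_val_neg (hq : ∀ x : H, x ^ q = 1) (x : H) (a : ZMod q) :
    x ^ (-a).val = (x ^ a.val)⁻¹ := by
  rw [eq_inv_iff_mul_eq_one, ← pow_val_add hq, neg_add_cancel, ZMod.val_zero, pow_zero]

theorem pow_val_sum (hq : ∀ x : H, x ^ q = 1) {ι : Type*} (s : Finset ι) (x : H)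
    (a : ι → ZMod q) : x ^ (∑ i ∈ s, a i).val = ∏ i ∈ s, x ^ (a i).val := by
  classical
  induction s using Finset.induction_on with
  | empty => simp
  | insert i s hi ih => rw [Finset.sum_insert hi, Finset.prod_insert hi, pow_val_add hq, ih]

/-- Exponentiating by a right-invertible matrix is undone by exponentiating by its inverse. -/
theorem prod_pow_val_of_mul_eq_one (hq : ∀ x : H, x ^ q = 1) (hone : (1 : ZMod q).val = 1)
    {ι : Type*} [Fintype ι] [DecidableEq ι] {U A : Matrix ι ι (ZMod q)} (hUA : U * A = 1)
    (d : ι → H) (l : ι) : ∏ j, (∏ i, d i ^ (U i j).val) ^ (A j l).val = d l := by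
  calc ∏ j, (∏ i, d i ^ (U i j).val) ^ (A j l).val
      = ∏ i, d i ^ ((U * A) i l).val := by
        simp_rw [Matrix.mul_apply, pow_val_sum hq, pow_val_mul hq, ← Finset.prod_pow]
        exact Finset.prod_comm
    _ = d l := by
        rw [hUA, Finset.prod_eq_single l]
        · rw [Matrix.one_apply_eq, hone, pow_one]
        · intro i _ hi
          rw [Matrix.one_apply_ne hi, ZMod.val_zero, pow_zero]
        · simp

theorem EncV_one_neg (hq : ∀ x : H, x ^ q = 1) {w : ℕ} (g pk : H) (r : Fin w → ZMod q) :
    EncV g pk 1 (fun k => -r k) = (EncV g pk 1 r)⁻¹ := by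
  simp_rw [EncV_one]
  exact funext fun k => Prod.ext (pow_val_neg hq g (r k)) (pow_val_neg hq pk (r k))

theorem EncV_one_sum (hq : ∀ x : H, x ^ q = 1) {w : ℕ} {ι : Type*} [Fintype ι] (g pk : H)
    (a : ι → ZMod q) (r : Fin w → ι → ZMod q) :
    EncV g pk 1 (fun k => ∑ j, a j * r k j) =
      ∏ j, EncV g pk 1 (fun k => r k j) ^ (a j).val := by
  have key (x : H) (k : Fin w) :
      x ^ (∑ j, a j * r k j).val = ∏ j, (x ^ (r k j).val) ^ (a j).val := by
    rw [pow_val_sum hq]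
    exact Finset.prod_congr rfl fun j _ => by rw [mul_comm, pow_val_mul hq]
  simp_rw [EncV_one]
  funext k
  rw [Finset.prod_apply]
  refine Prod.ext ?_ ?_
  · rw [Prod.fst_prod]
    exact key g k
  · rw [Prod.snd_prod]
    exact key pk k

end ZModExponent

theorem stmt_15 {q : ℕ} [Fact (Nat.Prime q)] {G : Type*} [CommGroup G] [Fintype G]
    (hcard : Fintype.card G = q) {N w : ℕ} (g pk : G)
    (U A : Matrix (Fin N) (Fin N) (ZMod q)) (hUA : U * A = 1) (hAU : A * U = 1)
    (M : Matrix (Fin N) (Fin N) (ZMod q)) (hM : IsPermMatrix M)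
    (π : Equiv.Perm (Fin N)) (hπ : ∀ (x : Fin N → ZMod q) (i : Fin N), M.mulVec x i = x (π i))
    (U' : Matrix (Fin N) (Fin N) (ZMod q)) (hU' : U' = M * U)
    (e e' : Fin N → Fin w → G × G) (Rs : Fin w → Fin N → ZMod q)
    (hopen : ∀ j, ∏ i, e i ^ U i j =
      (∏ i, e' i ^ U' i j) * EncV g pk 1 (fun k => -(Rs k j))) :
    ∀ l, e l = e' (π.symm l) * EncV g pk 1 (fun k => -(∑ j, A j l * Rs k j)) ∧
      e' (π.symm l) = ReEncV g pk (e l) (fun k => ∑ j, A j l * Rs k j) := by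
  have hq (x : G) : x ^ q = 1 := hcard ▸ pow_card_eq_one
  have hqV (x : Fin w → G × G) : x ^ q = 1 :=
    funext fun k => Prod.ext (hq (x k).1) (hq (x k).2)
  have hU'_apply (i j : Fin N) : U' i j = U (π i) j := by
    rw [hU']
    exact hπ (fun i => U i j) i
  have hquot (j : Fin N) : ∏ i, (e i / e' (π.symm i)) ^ (U i j).val =
      (EncV g pk 1 (fun k => Rs k j))⁻¹ := by
    have hj : ∏ i, e i ^ (U i j).val =
        (∏ i, e' i ^ (U' i j).val) * EncV g pk 1 (fun k => -(Rs k j)) := hopen j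
    have hperm : ∏ i, e' i ^ (U' i j).val = ∏ i, e' (π.symm i) ^ (U i j).val := by
      rw [← Equiv.prod_comp π (fun i => e' (π.symm i) ^ (U i j).val)]
      simp [hU'_apply]
    simp_rw [div_pow]
    rw [Finset.prod_div_distrib, hj, hperm, mul_div_cancel_left, EncV_one_neg hq]
  intro l
  have hl : e l / e' (π.symm l) = (EncV g pk 1 (fun k => ∑ j, A j l * Rs k j))⁻¹ := by
    rw [← prod_pow_val_of_mul_eq_one hqV (ZMod.val_one q) hUA
      (fun i => e i / e' (π.symm i)) l, EncV_one_sum hq]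
    simp_rw [hquot, inv_pow, Finset.prod_inv_distrib]
  have he : e l = e' (π.symm l) * (EncV g pk 1 (fun k => ∑ j, A j l * Rs k j))⁻¹ := by
    rw [← hl, mul_div_cancel]
  refine ⟨by rw [EncV_one_neg hq, he], ?_⟩
  rw [ReEncV, he, inv_mul_cancel_right]
end
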